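/- arXiv:1801.08060 — 2 statements merged into one kernel-verified Lean document; each statement's English description precedes it below -/
import Mathlib

section
/- Fix λ>1, r>0 with 1+r < λ−r, a point x₀ ∈ ℝ³ with 1+r < |x₀| < λ−r, and 0 < a < 3/2. Define f_{a,0}(x) = |x−x₀|^{-a} χ_{B_r(0)}(x−x₀) and f_a(x) = ∑_{k∈ℤ} λ^k f_{a,0}(λ^k x). Then: (i) if 0 < a ≤ 1, f_a belongs to L²_uloc(ℝ³), i.e. sup_{x∈ℝ³} ‖f_a‖_{L²(B(x,1))} < ∞; (ii) if 1 < a < 3/2, f_a does not belong to L²_uloc(ℝ³) (the L²-norms over unit balls are unbounded as the balls move toward spatial infinity along the dilated copies of the bump). -/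
open MeasureTheory Filter Metric Set
open scoped Topology ENNReal

noncomputable section

abbrev R3 : Type := EuclideanSpace ℝ (Fin 3)

/-- membership in `L²_uloc(ℝ³)`: the `L²` norms over all unit balls are uniformly bounded. -/
def MemL2Uloc (f : R3 → ℝ) : Prop :=
  ∃ C : ℝ≥0∞, C ≠ ⊤ ∧ ∀ x : R3, eLpNorm f 2 (volume.restrict (ball x 1)) ≤ C

/-- The singular bump `‖x - x₀‖ ^ (-a)` truncated to the ball of radius `r` around `x₀`. -/
def bump (x₀ : R3) (r a : ℝ) (x : R3) : ℝ :=
  Set.indicator (ball (0 : R3) r) (fun y : R3 => ‖y‖ ^ (-a)) (x - x₀)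

lemma bump_nonneg (x₀ : R3) (r a : ℝ) (x : R3) : 0 ≤ bump x₀ r a x :=
  Set.indicator_nonneg (fun y _ => Real.rpow_nonneg (norm_nonneg y) _) _

lemma bump_le (x₀ : R3) (r a : ℝ) (x : R3) : bump x₀ r a x ≤ ‖x - x₀‖ ^ (-a) :=
  Set.indicator_le_self' (fun y _ => Real.rpow_nonneg (norm_nonneg y) _) _

lemma bump_of_lt {x₀ : R3} {r a : ℝ} {x : R3} (h : ‖x - x₀‖ < r) :
    bump x₀ r a x = ‖x - x₀‖ ^ (-a) :=
  Set.indicator_of_mem (by simpa using h) _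

lemma norm_sub_lt_of_bump_ne_zero {x₀ : R3} {r a : ℝ} {x : R3} (h : bump x₀ r a x ≠ 0) :
    ‖x - x₀‖ < r := by
  simpa using Set.mem_of_indicator_ne_zero h

lemma measurable_bump (x₀ : R3) (r a : ℝ) : Measurable (bump x₀ r a) := by
  have h : Measurable (Set.indicator (ball (0 : R3) r) (fun y : R3 => ‖y‖ ^ (-a))) :=
    Measurable.indicator (by fun_prop) measurableSet_ball
  exact h.comp (measurable_id.sub_const x₀)

lemma norm_mem_Ioo_of_bump_ne_zero {x₀ : R3} {r a lam : ℝ} (hl : 1 + r < ‖x₀‖)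
    (hu : ‖x₀‖ < lam - r) {x : R3} (h : bump x₀ r a x ≠ 0) : 1 < ‖x‖ ∧ ‖x‖ < lam := by
  have h1 := norm_sub_lt_of_bump_ne_zero h
  have h2 := norm_sub_norm_le x x₀
  have h3 := norm_sub_norm_le x₀ x
  rw [norm_sub_rev] at h3
  constructor <;> linarith

/-- The copy of the bump dilated by the factor `lam ^ (-k)`. -/
def dilate (lam : ℝ) (x₀ : R3) (r a : ℝ) (k : ℤ) (x : R3) : ℝ :=
  lam ^ k * bump x₀ r a (lam ^ k • x)

lemma measurable_dilate (lam : ℝ) (x₀ : R3) (r a : ℝ) (k : ℤ) :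
    Measurable (dilate lam x₀ r a k) :=
  ((measurable_bump x₀ r a).comp (measurable_const_smul (lam ^ k))).const_mul _

lemma bounds_of_dilate_ne_zero {lam r a : ℝ} {x₀ : R3} (hlam : 1 < lam) (hl : 1 + r < ‖x₀‖)
    (hu : ‖x₀‖ < lam - r) {k : ℤ} {x : R3} (h : dilate lam x₀ r a k x ≠ 0) :
    1 < lam ^ k * ‖x‖ ∧ lam ^ k * ‖x‖ < lam := by
  have h1 := norm_mem_Ioo_of_bump_ne_zero hl hu (right_ne_zero_of_mul h)
  have h0 : 0 < lam ^ k := zpow_pos (by linarith) k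
  rwa [norm_smul, Real.norm_of_nonneg h0.le] at h1

lemma le_of_dilate_ne_zero {lam r a : ℝ} {x₀ : R3} (hlam : 1 < lam) (hl : 1 + r < ‖x₀‖)
    (hu : ‖x₀‖ < lam - r) {k l : ℤ} {x : R3} (hk : dilate lam x₀ r a k x ≠ 0)
    (hL : dilate lam x₀ r a l x ≠ 0) : l ≤ k := by
  by_contra! hkl
  obtain ⟨h1, -⟩ := bounds_of_dilate_ne_zero hlam hl hu hk
  obtain ⟨-, h2⟩ := bounds_of_dilate_ne_zero hlam hl hu hL
  have h3 : lam ^ (k + 1) ≤ lam ^ l := zpow_le_zpow_right₀ hlam.le (by omega)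
  rw [zpow_add₀ (by linarith), zpow_one] at h3
  nlinarith [mul_le_mul_of_nonneg_right h3 (norm_nonneg x)]

lemma tsum_dilate_eq {lam r a : ℝ} {x₀ : R3} (hlam : 1 < lam) (hl : 1 + r < ‖x₀‖)
    (hu : ‖x₀‖ < lam - r) {k : ℤ} {x : R3} (hk : dilate lam x₀ r a k x ≠ 0) :
    ∑' l : ℤ, dilate lam x₀ r a l x = dilate lam x₀ r a k x := by
  refine tsum_eq_single k fun l hlk => ?_
  by_contra hL
  exact hlk (le_antisymm (le_of_dilate_ne_zero hlam hl hu hk hL)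
    (le_of_dilate_ne_zero hlam hl hu hL hk))

lemma enorm_tsum_dilate_sq_le {lam r a : ℝ} {x₀ : R3} (hlam : 1 < lam) (hl : 1 + r < ‖x₀‖)
    (hu : ‖x₀‖ < lam - r) (x : R3) :
    ‖∑' l : ℤ, dilate lam x₀ r a l x‖ₑ ^ 2 ≤ ∑' l : ℤ, ‖dilate lam x₀ r a l x‖ₑ ^ 2 := by
  by_cases h : ∃ k, dilate lam x₀ r a k x ≠ 0
  · obtain ⟨k, hk⟩ := h
    rw [tsum_dilate_eq hlam hl hu hk]
    exact ENNReal.le_tsum (f := fun l => ‖dilate lam x₀ r a l x‖ₑ ^ 2) k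
  · push Not at h
    simp [h]

lemma enorm_norm_rpow_sq (a : ℝ) (y : R3) :
    ‖‖y‖ ^ (-a)‖ₑ ^ 2 = ‖‖y‖ ^ (-(2 * a))‖ₑ := by
  rw [← enorm_pow, ← Real.rpow_mul_natCast (norm_nonneg y)]
  congr 2
  push_cast
  ring

lemma setLIntegral_ball_norm_rpow_lt_top {a : ℝ} (ha : a < 3 / 2) (r : ℝ) :
    ∫⁻ y in ball (0 : R3) r, ‖‖y‖ ^ (-a)‖ₑ ^ 2 < ⊤ := by
  simp_rw [enorm_norm_rpow_sq]
  have : IntegrableOn (fun y : R3 => ‖y‖ ^ (-(2 * a))) (ball 0 r) := by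
    refine integrableOn_ball_of_norm_le_rpow (C := 1) (α := 2 * a) (by simp) ?_ ?_ ?_
    · simp only [finrank_euclideanSpace, Fintype.card_fin, Nat.cast_ofNat]
      linarith
    · refine Eventually.of_forall fun y => ?_
      rw [one_mul, Real.norm_of_nonneg (by positivity)]
    · exact Measurable.aestronglyMeasurable (by fun_prop)
  exact this.2

lemma setLIntegral_ball_norm_sub_rpow_le {a : ℝ} (ha : 0 < a) (x c : R3) :
    ∫⁻ y in ball x 1, ‖‖y - c‖ ^ (-a)‖ₑ ^ 2 ≤
      (∫⁻ y in ball (0 : R3) 1, ‖‖y‖ ^ (-a)‖ₑ ^ 2) + volume (ball (0 : R3) 1) := by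
  have hpt : ∀ y : R3, ‖‖y‖ ^ (-a)‖ₑ ^ 2 ≤
      (ball (0 : R3) 1).indicator (fun y => ‖‖y‖ ^ (-a)‖ₑ ^ 2) y + 1 := by
    intro y
    by_cases hy : y ∈ ball (0 : R3) 1
    · rw [Set.indicator_of_mem hy]
      exact le_self_add
    · rw [Set.indicator_of_notMem hy, zero_add]
      have hy1 : 1 ≤ ‖y‖ := by simpa using hy
      have h1 : ‖‖y‖ ^ (-a)‖ₑ ≤ 1 := by
        rw [Real.enorm_of_nonneg (by positivity)]
        exact ENNReal.ofReal_le_one.2 (Real.rpow_le_one_of_one_le_of_nonpos hy1 (by linarith))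
      exact pow_le_one' h1 2
  calc ∫⁻ y in ball x 1, ‖‖y - c‖ ^ (-a)‖ₑ ^ 2
      ≤ ∫⁻ y in ball x 1,
          ((ball (0 : R3) 1).indicator (fun y => ‖‖y‖ ^ (-a)‖ₑ ^ 2) (y - c) + 1) :=
        lintegral_mono fun y => hpt (y - c)
    _ = (∫⁻ y in ball x 1, (ball (0 : R3) 1).indicator (fun y => ‖‖y‖ ^ (-a)‖ₑ ^ 2) (y - c))
          + volume (ball x 1) := by
        rw [lintegral_add_right _ measurable_const]
        simp
    _ ≤ (∫⁻ y, (ball (0 : R3) 1).indicator (fun y => ‖‖y‖ ^ (-a)‖ₑ ^ 2) (y - c))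
          + volume (ball x 1) := by
        gcongr
        exact Measure.restrict_le_self
    _ = _ := by
        rw [lintegral_sub_right_eq_self
          (fun y => (ball (0 : R3) 1).indicator (fun y => ‖‖y‖ ^ (-a)‖ₑ ^ 2) y) c,
          lintegral_indicator measurableSet_ball, Measure.addHaar_ball_center]

lemma dilate_nonneg {lam : ℝ} (hlam : 0 < lam) (x₀ : R3) (r a : ℝ) (k : ℤ) (x : R3) :
    0 ≤ dilate lam x₀ r a k x :=
  mul_nonneg (zpow_pos hlam k).le (bump_nonneg _ _ _ _)

lemma mul_norm_smul_sub_rpow {c : ℝ} (hc : 0 < c) (x₀ y : R3) (a : ℝ) :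
    c * ‖c • y - x₀‖ ^ (-a) = c ^ (1 - a) * ‖y - c⁻¹ • x₀‖ ^ (-a) := by
  have h : c • y - x₀ = c • (y - c⁻¹ • x₀) := by
    rw [smul_sub, smul_inv_smul₀ hc.ne']
  rw [h, norm_smul, Real.norm_of_nonneg hc.le, Real.mul_rpow hc.le (norm_nonneg _), ← mul_assoc,
    sub_eq_add_neg 1 a, Real.rpow_add hc, Real.rpow_one]

lemma dilate_le {lam : ℝ} (hlam : 1 < lam) (x₀ : R3) (r : ℝ) {a : ℝ} (ha : a ≤ 1) {k : ℤ}
    (hk : k ≤ 0) (y : R3) :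
    dilate lam x₀ r a k y ≤ ‖y - (lam ^ k)⁻¹ • x₀‖ ^ (-a) := by
  have h0 : 0 < lam ^ k := zpow_pos (by linarith) k
  calc dilate lam x₀ r a k y ≤ lam ^ k * ‖lam ^ k • y - x₀‖ ^ (-a) :=
        mul_le_mul_of_nonneg_left (bump_le _ _ _ _) h0.le
    _ = (lam ^ k) ^ (1 - a) * ‖y - (lam ^ k)⁻¹ • x₀‖ ^ (-a) := mul_norm_smul_sub_rpow h0 ..
    _ ≤ 1 * ‖y - (lam ^ k)⁻¹ • x₀‖ ^ (-a) := by
        gcongr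
        exact Real.rpow_le_one h0.le (zpow_le_one_of_nonpos₀ hlam.le hk) (by linarith)
    _ = _ := one_mul _

lemma lintegral_dilate_sq {lam : ℝ} (hlam : 0 < lam) (x₀ : R3) (r a : ℝ) (k : ℤ) :
    ∫⁻ y, ‖dilate lam x₀ r a k y‖ₑ ^ 2 =
      ENNReal.ofReal ((lam ^ k)⁻¹) * ∫⁻ y in ball (0 : R3) r, ‖‖y‖ ^ (-a)‖ₑ ^ 2 := by
  have h0 : 0 < lam ^ k := zpow_pos hlam k
  have hm : Measurable fun y => ‖bump x₀ r a y‖ₑ ^ 2 := (measurable_bump x₀ r a).enorm.pow_const 2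
  have h1 : ∫⁻ y, ‖bump x₀ r a (lam ^ k • y)‖ₑ ^ 2 =
      ENNReal.ofReal (((lam ^ k) ^ 3)⁻¹) * ∫⁻ y, ‖bump x₀ r a y‖ₑ ^ 2 := by
    rw [← lintegral_map (μ := volume) hm (measurable_const_smul (lam ^ k)),
      Measure.map_addHaar_smul _ h0.ne', lintegral_smul_measure]
    simp [abs_of_pos h0]
  have h2 : ∫⁻ y, ‖bump x₀ r a y‖ₑ ^ 2 = ∫⁻ y in ball (0 : R3) r, ‖‖y‖ ^ (-a)‖ₑ ^ 2 := by
    rw [← lintegral_indicator measurableSet_ball, ← lintegral_sub_right_eq_self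
      ((ball (0 : R3) r).indicator fun y => ‖‖y‖ ^ (-a)‖ₑ ^ 2) x₀]
    refine lintegral_congr fun y => ?_
    unfold bump
    by_cases hy : y - x₀ ∈ ball (0 : R3) r
    · rw [Set.indicator_of_mem hy, Set.indicator_of_mem hy]
    · rw [Set.indicator_of_notMem hy, Set.indicator_of_notMem hy]
      simp
  simp_rw [dilate, enorm_mul, mul_pow]
  rw [lintegral_const_mul' _ _ (by finiteness), h1, h2, ← mul_assoc,
    Real.enorm_of_nonneg h0.le, ← ENNReal.ofReal_pow h0.le, ← ENNReal.ofReal_mul (by positivity)]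
  congr 2
  field_simp

/-- A series bounded by `C` whose nonzero terms lie in a window of length `N` sums to at most
`N * C`. -/
lemma ENNReal.tsum_le_of_window {u : ℕ → ℝ≥0∞} {C : ℝ≥0∞} {N : ℕ} (hC : ∀ n, u n ≤ C)
    (hN : ∀ i j, u i ≠ 0 → u j ≠ 0 → j < i + N) : ∑' n, u n ≤ N * C := by
  classical
  by_cases h : ∃ n, u n ≠ 0
  · rw [tsum_eq_sum (s := Finset.Ico (Nat.find h) (Nat.find h + N))]
    · calc _ ≤ ∑ _n ∈ Finset.Ico (Nat.find h) (Nat.find h + N), C :=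
            Finset.sum_le_sum fun n _ => hC n
        _ = N * C := by simp
    · intro n hn
      by_contra hne
      exact hn (Finset.mem_Ico.2 ⟨Nat.find_min' h hne, hN _ _ (Nat.find_spec h) hne⟩)
  · push Not at h
    simp [h]

lemma window_of_setLIntegral_ne_zero {lam r a : ℝ} {x₀ : R3} (hlam : 1 < lam)
    (hl : 1 + r < ‖x₀‖) (hu : ‖x₀‖ < lam - r) {N : ℕ} (hN : 3 * lam ≤ lam ^ N) {x : R3} {i j : ℕ}
    (hi : ∫⁻ y in ball x 1, ‖dilate lam x₀ r a (-(i + 1)) y‖ₑ ^ 2 ≠ 0)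
    (hj : ∫⁻ y in ball x 1, ‖dilate lam x₀ r a (-(j + 1)) y‖ₑ ^ 2 ≠ 0) : j < i + N := by
  have key : ∀ n : ℕ, ∫⁻ y in ball x 1, ‖dilate lam x₀ r a (-(n + 1)) y‖ₑ ^ 2 ≠ 0 →
      ∃ y ∈ ball x 1, lam ^ (n + 1) < ‖y‖ ∧ ‖y‖ < lam ^ (n + 1) * lam := by
    intro n hn
    by_contra! hcon
    refine hn ((setLIntegral_congr_fun measurableSet_ball fun y hy => ?_).trans lintegral_zero)
    have : dilate lam x₀ r a (-(n + 1)) y = 0 := by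
      by_contra hne
      obtain ⟨h1, h2⟩ := bounds_of_dilate_ne_zero hlam hl hu hne
      have hp : 0 < lam ^ (n + 1) := by positivity
      rw [zpow_neg, ← Nat.cast_succ, zpow_natCast, inv_mul_eq_div] at h1 h2
      rw [lt_div_iff₀ hp, one_mul] at h1
      rw [div_lt_iff₀ hp, mul_comm] at h2
      exact absurd h2 (hcon y hy h1).not_gt
    simp only [this, enorm_zero, ne_eq, OfNat.ofNat_ne_zero, not_false_eq_true, zero_pow]
  obtain ⟨y, hy, -, hy2⟩ := key i hi
  obtain ⟨z, hz, hz1, -⟩ := key j hj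
  by_contra! hij
  have h1 : lam ^ (i + N + 1) ≤ lam ^ (j + 1) := pow_le_pow_right₀ hlam.le (by omega)
  have h2 : ‖z‖ < ‖y‖ + 2 := by
    have := norm_sub_norm_le z y
    have := dist_triangle_right z y x
    rw [mem_ball] at hy hz
    rw [dist_eq_norm] at this
    linarith
  have h3 : 1 ≤ lam ^ (i + 1) := one_le_pow₀ hlam.le
  have h4 : lam ^ (i + N + 1) = lam ^ (i + 1) * lam ^ N := by ring
  nlinarith [mul_le_mul_of_nonneg_left hN (zero_le_one.trans h3)]

lemma eLpNorm_two_le_of_lintegral_le {μ : Measure R3} {f : R3 → ℝ} {S : ℝ≥0∞}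
    (h : ∫⁻ y, ‖f y‖ₑ ^ 2 ∂μ ≤ S) : eLpNorm f 2 μ ≤ S ^ (1 / 2 : ℝ) := by
  rw [eLpNorm_eq_lintegral_rpow_enorm_toReal (by simp) (by simp)]
  simp only [ENNReal.toReal_ofNat, ENNReal.rpow_ofNat]
  exact ENNReal.rpow_le_rpow h (by norm_num)

lemma memL2Uloc_tsum_dilate {lam r a : ℝ} {x₀ : R3} (hlam : 1 < lam) (hl : 1 + r < ‖x₀‖)
    (hu : ‖x₀‖ < lam - r) (ha : 0 < a) (ha1 : a ≤ 1) :
    MemL2Uloc fun x => ∑' k : ℤ, dilate lam x₀ r a k x := by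
  obtain ⟨N, hN⟩ := pow_unbounded_of_one_lt (3 * lam) hlam
  set J : ℝ≥0∞ := ∫⁻ y in ball (0 : R3) r, ‖‖y‖ ^ (-a)‖ₑ ^ 2
  set K : ℝ≥0∞ := (∫⁻ y in ball (0 : R3) 1, ‖‖y‖ ^ (-a)‖ₑ ^ 2) + volume (ball (0 : R3) 1)
  set q : ℝ≥0∞ := ENNReal.ofReal lam⁻¹
  have hJ : J ≠ ⊤ := (setLIntegral_ball_norm_rpow_lt_top (by linarith) r).ne
  have hK : K ≠ ⊤ := ENNReal.add_ne_top.2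
    ⟨(setLIntegral_ball_norm_rpow_lt_top (by linarith) 1).ne, measure_ball_lt_top.ne⟩
  have hq : q < 1 := ENNReal.ofReal_lt_one.2 (inv_lt_one_of_one_lt₀ hlam)
  have hS : (1 - q)⁻¹ * J + N * K ≠ ⊤ := by
    have : (1 - q)⁻¹ ≠ ⊤ := ENNReal.inv_ne_top.2 (tsub_pos_of_lt hq).ne'
    finiteness
  refine ⟨((1 - q)⁻¹ * J + N * K) ^ (1 / 2 : ℝ),
    ENNReal.rpow_ne_top_of_nonneg (by norm_num) hS, fun x => eLpNorm_two_le_of_lintegral_le ?_⟩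
  calc ∫⁻ y in ball x 1, ‖∑' k : ℤ, dilate lam x₀ r a k y‖ₑ ^ 2
      ≤ ∫⁻ y in ball x 1, ∑' k : ℤ, ‖dilate lam x₀ r a k y‖ₑ ^ 2 :=
        lintegral_mono fun y => enorm_tsum_dilate_sq_le hlam hl hu y
    _ = ∑' k : ℤ, ∫⁻ y in ball x 1, ‖dilate lam x₀ r a k y‖ₑ ^ 2 :=
        lintegral_tsum fun k => ((measurable_dilate lam x₀ r a k).enorm.pow_const 2).aemeasurable
    _ = (∑' n : ℕ, ∫⁻ y in ball x 1, ‖dilate lam x₀ r a n y‖ₑ ^ 2) +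
          ∑' n : ℕ, ∫⁻ y in ball x 1, ‖dilate lam x₀ r a (-(n + 1)) y‖ₑ ^ 2 :=
        tsum_of_nat_of_neg_add_one ENNReal.summable ENNReal.summable
    _ ≤ (1 - q)⁻¹ * J + N * K := by
        refine add_le_add ?_ (ENNReal.tsum_le_of_window (fun n => ?_)
          fun i j => window_of_setLIntegral_ne_zero hlam hl hu hN.le)
        · rw [← ENNReal.tsum_geometric, ← ENNReal.tsum_mul_right]
          refine ENNReal.tsum_le_tsum fun n => (setLIntegral_le_lintegral _ _).trans ?_
          rw [lintegral_dilate_sq (by linarith), zpow_natCast, ← inv_pow,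
            ENNReal.ofReal_pow (by positivity)]
        · refine (lintegral_mono fun y => ?_).trans
            (setLIntegral_ball_norm_sub_rpow_le ha x ((lam ^ (-(n + 1) : ℤ))⁻¹ • x₀))
          gcongr
          rw [Real.enorm_of_nonneg (dilate_nonneg (by linarith) ..),
            Real.enorm_of_nonneg (by positivity)]
          exact ENNReal.ofReal_le_ofReal (dilate_le hlam x₀ r ha1 (by omega) y)

lemma not_memL2Uloc_tsum_dilate {lam r a : ℝ} {x₀ : R3} (hlam : 1 < lam) (hr : 0 < r)
    (hl : 1 + r < ‖x₀‖) (hu : ‖x₀‖ < lam - r) (ha1 : 1 < a) :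
    ¬ MemL2Uloc fun x => ∑' k : ℤ, dilate lam x₀ r a k x := by
  rintro ⟨C, hC, hbd⟩
  have hlam0 : 0 < lam := by linarith
  set V : ℝ≥0∞ := volume (ball (0 : R3) 1) ^ (1 / 2 : ℝ)
  have hV : V ≠ 0 :=
    (ENNReal.rpow_pos (measure_ball_pos volume (0 : R3) one_pos) measure_ball_lt_top.ne).ne'
  have hlow : ∀ n : ℕ, 1 ≤ lam ^ n * r → ENNReal.ofReal ((lam ^ n) ^ (a - 1)) * V ≤ C := by
    intro n hn
    have hp : 0 < lam ^ n := by positivity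
    set c : R3 := lam ^ n • x₀
    refine le_trans ?_ (hbd c)
    calc ENNReal.ofReal ((lam ^ n) ^ (a - 1)) * V
        = eLpNorm (fun _ : R3 => (lam ^ n) ^ (a - 1)) 2 (volume.restrict (ball c 1)) := by
          rw [eLpNorm_const' _ (by simp) (by simp), Real.enorm_of_nonneg (by positivity),
            Measure.restrict_apply_univ, Measure.addHaar_ball_center]
          simp [V]
      _ ≤ _ := by
          refine eLpNorm_mono_ae ?_
          filter_upwards [ae_restrict_mem measurableSet_ball,
            ae_restrict_of_ae (Measure.ae_ne volume c)] with y hy hyc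
          have hy1 : ‖y - c‖ < 1 := by simpa [dist_eq_norm] using hy
          have hy0 : 0 < ‖y - c‖ := norm_pos_iff.2 (sub_ne_zero.2 hyc)
          have hz : (lam ^ (-(n : ℤ)))⁻¹ = lam ^ n := by simp
          have hz' : lam ^ (-(n : ℤ)) = (lam ^ n)⁻¹ := by simp
          have hsub : lam ^ (-(n : ℤ)) • y - x₀ = (lam ^ n)⁻¹ • (y - c) := by
            rw [smul_sub, inv_smul_smul₀ hp.ne', hz']
          have hin : ‖lam ^ (-(n : ℤ)) • y - x₀‖ < r := by
            rw [hsub, norm_smul, norm_inv, Real.norm_of_nonneg hp.le, inv_mul_lt_iff₀ hp]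
            linarith
          have hval : dilate lam x₀ r a (-n) y = (lam ^ n) ^ (a - 1) * ‖y - c‖ ^ (-a) := by
            rw [dilate, bump_of_lt hin, mul_norm_smul_sub_rpow (zpow_pos hlam0 _), hz, hz',
              Real.inv_rpow hp.le, ← Real.rpow_neg hp.le, neg_sub]
          have hge : (lam ^ n) ^ (a - 1) ≤ dilate lam x₀ r a (-n) y := by
            rw [hval]
            exact le_mul_of_one_le_right (by positivity)
              (Real.one_le_rpow_of_pos_of_le_one_of_nonpos hy0 hy1.le (by linarith))
          have hpos : 0 < (lam ^ n) ^ (a - 1) := by positivity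
          rw [tsum_dilate_eq hlam hl hu (hpos.trans_le hge).ne', Real.norm_of_nonneg hpos.le]
          exact hge.trans (le_abs_self _)
  have htop : Tendsto (fun n : ℕ => ENNReal.ofReal ((lam ^ n) ^ (a - 1)) * V) atTop (𝓝 ⊤) := by
    have h1 := ENNReal.tendsto_ofReal_atTop.comp ((tendsto_rpow_atTop (sub_pos.2 ha1)).comp
      (tendsto_pow_atTop_atTop_of_one_lt hlam))
    have h2 := ENNReal.Tendsto.mul_const (b := V) h1 (Or.inl ENNReal.top_ne_zero)
    rwa [ENNReal.top_mul hV] at h2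
  have hev : ∀ᶠ n : ℕ in atTop, 1 ≤ lam ^ n * r :=
    ((tendsto_pow_atTop_atTop_of_one_lt hlam).atTop_mul_const hr).eventually_ge_atTop 1
  exact hC (top_le_iff.1 (le_of_tendsto htop (hev.mono hlow)))

/-- the λ-DSS function `f_a(x) = ∑_{k∈ℤ} λ^k f_{a,0}(λ^k x)` with
`f_{a,0}(x) = |x−x₀|^{-a} χ_{B_r(0)}(x−x₀)` belongs to `L²_uloc` iff `0 < a ≤ 1`:
it is in `L²_uloc` when `a ≤ 1` and fails to be in `L²_uloc` when `1 < a < 3/2`. -/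
theorem stmt12 (lam r a : ℝ) (x₀ : R3) (hlam : 1 < lam) (hr : 0 < r)
    (hsep : 1 + r < lam - r) (hx₀l : 1 + r < ‖x₀‖) (hx₀u : ‖x₀‖ < lam - r)
    (ha : 0 < a) (ha' : a < 3 / 2)
    (f0 : R3 → ℝ)
    (hf0 : ∀ x : R3,
      f0 x = Set.indicator (ball (0:R3) r) (fun y : R3 => ‖y‖ ^ (-a)) (x - x₀))
    (f : R3 → ℝ)
    (hf : ∀ x : R3, f x = ∑' k : ℤ, (lam ^ k : ℝ) * f0 ((lam ^ k : ℝ) • x)) :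
    (a ≤ 1 → MemL2Uloc f) ∧ (1 < a → ¬ MemL2Uloc f) := by
  obtain rfl : f0 = bump x₀ r a := funext hf0
  obtain rfl : f = fun x => ∑' k : ℤ, dilate lam x₀ r a k x := funext hf
  exact ⟨memL2Uloc_tsum_dilate hlam hx₀l hx₀u ha,
    not_memL2Uloc_tsum_dilate hlam hr hx₀l hx₀u⟩
end
end

section
/- Let λ > 1, T > 0, and let h : ℝ³×(0,∞) → ℝ be measurable with the scaling property h(y,t) = λ² h(λy, λ²t) (as holds for the product of two λ-DSS vector fields) and with ∫₀^T∫_{B₁}|h|^{3/2} dy dt < ∞. For fixed indices i,j, define p(x,t) = ∫_{|y| ≥ λ²} K_{ij}(x−y) h(y,t) dy for x ∈ B_λ, where K_{ij}(x) = ∂_i∂_j(1/(4π|x|)). Then there is a constant C(λ), depending only on λ, such that ∫₀^T ∫_{B_λ} |p(x,t)|^{3/2} dx dt ≤ C(λ) ∫₀^T ∫_{B₁} |h(z,τ)|^{3/2} dz dτ. -/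
open MeasureTheory Filter Metric Set
open scoped Topology ENNReal

noncomputable section

def e3 (i : Fin 3) : R3 := EuclideanSpace.single i 1
def pdS (i : Fin 3) (f : R3 → ℝ) (x : R3) : ℝ := fderiv ℝ f x (e3 i)

/-- The kernel `K_{ij}(x) = ∂_i ∂_j (1/(4π|x|))`. -/
def Kker (i j : Fin 3) (x : R3) : ℝ :=
  pdS i (fun z => pdS j (fun w : R3 => 1 / (4 * Real.pi * ‖w‖)) z) x

lemma hasFDerivAt_norm_rpow_of_ne_zero (s : ℝ) {z : R3} (hz : z ≠ 0) :
    HasFDerivAt (fun w : R3 => ‖w‖ ^ s) ((s * ‖z‖ ^ (s - 2)) • innerSL ℝ z) z := by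
  have h0 : 0 < ‖z‖ := norm_pos_iff.2 hz
  have h := (HasFDerivAt.norm_sq (hasFDerivAt_id z)).rpow_const (p := s / 2)
    (Or.inl (by positivity))
  have e : (fun w : R3 => (‖id w‖ ^ 2) ^ (s / 2)) = fun w => ‖w‖ ^ s := by
    funext w
    rw [id, ← Real.rpow_natCast, ← Real.rpow_mul (norm_nonneg w)]
    congr 1; push_cast; ring
  rw [e] at h
  refine h.congr_fderiv ?_
  ext v
  have e2 : (‖z‖ ^ 2) ^ (s / 2 - 1) = ‖z‖ ^ (s - 2) := by
    rw [← Real.rpow_natCast, ← Real.rpow_mul (norm_nonneg z)]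
    congr 1; push_cast; ring
  simp [e2]
  ring

lemma pdS_newtonian (j : Fin 3) {z : R3} (hz : z ≠ 0) :
    pdS j (fun w : R3 => 1 / (4 * Real.pi * ‖w‖)) z
      = -(4 * Real.pi)⁻¹ * (‖z‖ ^ (-3 : ℝ) * z j) := by
  have h := (hasFDerivAt_norm_rpow_of_ne_zero (-1) hz).const_mul (4 * Real.pi)⁻¹
  have e : (fun w : R3 => 1 / (4 * Real.pi * ‖w‖))
      = fun w => (4 * Real.pi)⁻¹ * ‖w‖ ^ (-1 : ℝ) := by
    funext w
    rw [Real.rpow_neg_one, one_div, mul_inv]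
  rw [pdS, e, h.fderiv]
  norm_num [e3, EuclideanSpace.inner_single_right]

lemma Kker_eq (i j : Fin 3) {z : R3} (hz : z ≠ 0) :
    Kker i j z = -(4 * Real.pi)⁻¹ *
      (‖z‖ ^ (-3 : ℝ) * e3 i j - 3 * ‖z‖ ^ (-5 : ℝ) * z i * z j) := by
  have hev : (fun w => pdS j (fun w : R3 => 1 / (4 * Real.pi * ‖w‖)) w)
      =ᶠ[𝓝 z] fun w => -(4 * Real.pi)⁻¹ * (‖w‖ ^ (-3 : ℝ) * w j) := by
    filter_upwards [isOpen_ne.mem_nhds hz] with w hw using pdS_newtonian j hw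
  have hj : HasFDerivAt (fun w : R3 => w j) (EuclideanSpace.proj j : R3 →L[ℝ] ℝ) z :=
    (EuclideanSpace.proj j : R3 →L[ℝ] ℝ).hasFDerivAt
  have h := ((hasFDerivAt_norm_rpow_of_ne_zero (-3) hz).mul hj).const_mul (-(4 * Real.pi)⁻¹)
  rw [Kker, pdS, hev.fderiv_eq]
  erw [h.fderiv]
  norm_num [e3, EuclideanSpace.inner_single_right]
  split_ifs <;> ring

lemma abs_Kker_le (i j : Fin 3) {z : R3} (hz : z ≠ 0) : |Kker i j z| ≤ ‖z‖ ^ (-3 : ℝ) := by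
  have h0 : 0 < ‖z‖ := norm_pos_iff.2 hz
  have hi : |z i| ≤ ‖z‖ := PiLp.norm_apply_le z i
  have hj : |z j| ≤ ‖z‖ := PiLp.norm_apply_le z j
  have hij : |e3 i j| ≤ 1 := by
    simp only [e3, PiLp.single_apply]
    split_ifs <;> simp
  have e5 : ‖z‖ ^ (-5 : ℝ) * (‖z‖ * ‖z‖) = ‖z‖ ^ (-3 : ℝ) := by
    rw [← pow_two, ← Real.rpow_natCast, ← Real.rpow_add h0]
    norm_num
  have hp3 : 0 < ‖z‖ ^ (-3 : ℝ) := by positivity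
  have hp5 : 0 < ‖z‖ ^ (-5 : ℝ) := by positivity
  have hpi : (4 * Real.pi)⁻¹ ≤ 4⁻¹ := by
    gcongr
    linarith [Real.pi_gt_three]
  have hb : |‖z‖ ^ (-3 : ℝ) * e3 i j - 3 * ‖z‖ ^ (-5 : ℝ) * z i * z j|
      ≤ 4 * ‖z‖ ^ (-3 : ℝ) := by
    calc _ ≤ |‖z‖ ^ (-3 : ℝ) * e3 i j| + |3 * ‖z‖ ^ (-5 : ℝ) * z i * z j| := abs_sub _ _
      _ = ‖z‖ ^ (-3 : ℝ) * |e3 i j| + 3 * (‖z‖ ^ (-5 : ℝ) * (|z i| * |z j|)) := by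
        simp only [abs_mul, abs_of_pos hp3, abs_of_pos hp5]
        norm_num; ring
      _ ≤ ‖z‖ ^ (-3 : ℝ) * 1 + 3 * (‖z‖ ^ (-5 : ℝ) * (‖z‖ * ‖z‖)) := by gcongr
      _ = _ := by rw [e5]; ring
  rw [Kker_eq i j hz, abs_mul, abs_neg, abs_of_pos (by positivity)]
  calc _ ≤ 4⁻¹ * (4 * ‖z‖ ^ (-3 : ℝ)) := by gcongr
    _ = _ := by ring

lemma setLIntegral_smul_comp {E : Type*} [NormedAddCommGroup E] [NormedSpace ℝ E]
    [MeasurableSpace E] [BorelSpace E] [FiniteDimensional ℝ E] (μ : Measure E)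
    [μ.IsAddHaarMeasure] {r : ℝ} (hr : 0 < r) {s t : Set E} (hs : ∀ x, r • x ∈ s ↔ x ∈ t)
    (f : E → ℝ≥0∞) :
    ∫⁻ x in s, f x ∂μ = ENNReal.ofReal (r ^ Module.finrank ℝ E) * ∫⁻ x in t, f (r • x) ∂μ := by
  have hpos : 0 < r ^ Module.finrank ℝ E := pow_pos hr _
  have he : MeasurableEmbedding (fun x : E => r • x) :=
    (Homeomorph.smulOfNeZero r hr.ne').measurableEmbedding
  have hpre : (fun x : E => r • x) ⁻¹' s = t := Set.ext hs
  rw [← hpre, ← he.lintegral_map, ← he.restrict_map, Measure.map_addHaar_smul μ hr.ne',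
    Measure.restrict_smul, lintegral_smul_measure, smul_eq_mul, ← mul_assoc,
    abs_of_pos (inv_pos.2 hpos), ← ENNReal.ofReal_mul hpos.le, mul_inv_cancel₀ hpos.ne',
    ENNReal.ofReal_one, one_mul]

lemma lintegral_ball_mul_scaling {G : R3 → ℝ → ℝ≥0∞} {lam : ℝ} (hlam : 0 < lam)
    (hG : ∀ y t, 0 < t → G y t = ENNReal.ofReal (lam ^ 3) * G (lam • y) (lam ^ 2 * t))
    (R T : ℝ) :
    ∫⁻ t in Ioc 0 (lam ^ 2 * T), ∫⁻ y in ball (0 : R3) (lam * R), G y t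
      = ENNReal.ofReal (lam ^ 2) * ∫⁻ t in Ioc 0 T, ∫⁻ y in ball (0 : R3) R, G y t := by
  have h2 : 0 < lam ^ 2 := pow_pos hlam 2
  rw [setLIntegral_smul_comp volume h2 (t := Ioc 0 T)]
  · rw [Module.finrank_self, pow_one]
    congr 1
    refine setLIntegral_congr_fun measurableSet_Ioc fun t ht => ?_
    rw [setLIntegral_smul_comp volume hlam (t := ball (0 : R3) R)]
    · rw [finrank_euclideanSpace_fin, ← lintegral_const_mul' _ _ ENNReal.ofReal_ne_top]
      exact lintegral_congr fun y => (hG y t ht.1).symm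
    · intro x
      rw [mem_ball_zero_iff, mem_ball_zero_iff, norm_smul, Real.norm_of_nonneg hlam.le,
        mul_lt_mul_iff_right₀ hlam]
  · intro t
    simp only [smul_eq_mul, mem_Ioc]
    rw [mul_pos_iff_of_pos_left h2, mul_le_mul_iff_right₀ h2]

lemma lintegral_ball_pow_le {G : R3 → ℝ → ℝ≥0∞} {lam : ℝ} (hlam : 1 < lam)
    (hG : ∀ y t, 0 < t → G y t = ENNReal.ofReal (lam ^ 3) * G (lam • y) (lam ^ 2 * t))
    {T : ℝ} (hT : 0 < T) (k : ℕ) :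
    ∫⁻ t in Ioc 0 T, ∫⁻ y in ball (0 : R3) (lam ^ k), G y t
      ≤ ENNReal.ofReal (lam ^ 2) ^ k * ∫⁻ t in Ioc 0 T, ∫⁻ y in ball (0 : R3) 1, G y t := by
  have h0 : 0 < lam := one_pos.trans hlam
  induction k with
  | zero => simp
  | succ k ih =>
    have hle : T / lam ^ 2 ≤ T := div_le_self hT.le (one_le_pow₀ hlam.le)
    have hT' : lam ^ 2 * (T / lam ^ 2) = T := by field_simp
    calc ∫⁻ t in Ioc 0 T, ∫⁻ y in ball (0 : R3) (lam ^ (k + 1)), G y t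
        = ENNReal.ofReal (lam ^ 2) *
            ∫⁻ t in Ioc 0 (T / lam ^ 2), ∫⁻ y in ball (0 : R3) (lam ^ k), G y t := by
          rw [← lintegral_ball_mul_scaling h0 hG, hT', pow_succ']
      _ ≤ ENNReal.ofReal (lam ^ 2) *
            ∫⁻ t in Ioc 0 T, ∫⁻ y in ball (0 : R3) (lam ^ k), G y t := by
          gcongr
      _ ≤ _ := by
          rw [pow_succ' _ k, mul_assoc]
          gcongr

/-- The weight `(1 + ‖y‖) ^ (-5/2)` is dominated on `1 ≤ ‖y‖` by a superposition of balls. -/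
lemma weight_le_tsum {lam : ℝ} (hlam : 1 < lam) {y : R3} (hy : 1 ≤ ‖y‖) :
    ENNReal.ofReal ((1 + ‖y‖) ^ (-(5 / 2) : ℝ)) ≤ ENNReal.ofReal (lam ^ (5 / 2 : ℝ)) *
      ∑' k : ℕ, ENNReal.ofReal (lam ^ (-(5 / 2) : ℝ)) ^ k *
        (ball (0 : R3) (lam ^ k)).indicator 1 y := by
  have h0 : 0 < lam := one_pos.trans hlam
  obtain ⟨n, hn, hn'⟩ := exists_nat_pow_near hy hlam
  refine le_trans ?_ (mul_le_mul_right (ENNReal.le_tsum (n + 1)) _)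
  rw [indicator_of_mem (mem_ball_zero_iff.2 hn'), Pi.one_apply, mul_one,
    ← ENNReal.ofReal_pow (by positivity), ← ENNReal.ofReal_mul (by positivity)]
  refine ENNReal.ofReal_le_ofReal ?_
  calc (1 + ‖y‖) ^ (-(5 / 2) : ℝ) ≤ (lam ^ n) ^ (-(5 / 2) : ℝ) :=
        Real.rpow_le_rpow_of_nonpos (by positivity) (by linarith) (by norm_num)
    _ = _ := by
        rw [pow_succ', ← mul_assoc, ← Real.rpow_add h0, ← Real.rpow_natCast, ← Real.rpow_mul h0.le,
          ← Real.rpow_natCast, ← Real.rpow_mul h0.le, mul_comm (n : ℝ)]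
        norm_num

lemma lintegral_weight_le {G : R3 → ℝ → ℝ≥0∞} {lam : ℝ} (hlam : 1 < lam)
    (hGm : Measurable fun q : R3 × ℝ => G q.1 q.2)
    (hG : ∀ y t, 0 < t → G y t = ENNReal.ofReal (lam ^ 3) * G (lam • y) (lam ^ 2 * t))
    {T : ℝ} (hT : 0 < T) :
    ∫⁻ t in Ioc 0 T, ∫⁻ y in {y : R3 | lam ^ 2 ≤ ‖y‖},
        G y t * ENNReal.ofReal ((1 + ‖y‖) ^ (-(5 / 2) : ℝ))
      ≤ ENNReal.ofReal (lam ^ (5 / 2 : ℝ)) * (∑' k : ℕ, ENNReal.ofReal (lam ^ (-(1 / 2) : ℝ)) ^ k) *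
        ∫⁻ t in Ioc 0 T, ∫⁻ y in ball (0 : R3) 1, G y t := by
  have h0 : 0 < lam := one_pos.trans hlam
  have hGt (t : ℝ) : Measurable fun y => G y t := hGm.comp measurable_prodMk_right
  set a := ENNReal.ofReal (lam ^ (-(5 / 2) : ℝ))
  set b := ENNReal.ofReal (lam ^ (5 / 2 : ℝ))
  calc _ ≤ ∫⁻ t in Ioc 0 T, b * ∑' k : ℕ, a ^ k * ∫⁻ y in ball (0 : R3) (lam ^ k), G y t := by
        refine lintegral_mono fun t => ?_
        calc _ ≤ ∫⁻ y in {y : R3 | lam ^ 2 ≤ ‖y‖},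
              b * ∑' k : ℕ, a ^ k * (ball (0 : R3) (lam ^ k)).indicator (fun y => G y t) y := by
              refine setLIntegral_mono' (measurableSet_le measurable_const measurable_norm)
                fun y hy => ?_
              have hy1 : 1 ≤ ‖y‖ := (one_le_pow₀ hlam.le).trans hy
              calc _ ≤ G y t * (b * ∑' k : ℕ, a ^ k *
                    (ball (0 : R3) (lam ^ k)).indicator 1 y) := by
                    gcongr
                    exact weight_le_tsum hlam hy1
                _ = _ := by
                    rw [mul_left_comm, ← ENNReal.tsum_mul_left]
                    congr 2
                    funext k
                    by_cases hk : y ∈ ball (0 : R3) (lam ^ k)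
                    · simp [indicator_of_mem hk, mul_comm]
                    · simp [indicator_of_notMem hk]
          _ ≤ ∫⁻ y, b * ∑' k : ℕ,
              a ^ k * (ball (0 : R3) (lam ^ k)).indicator (fun y => G y t) y :=
              setLIntegral_le_lintegral _ _
          _ = _ := by
              rw [lintegral_const_mul' _ _ ENNReal.ofReal_ne_top, lintegral_tsum]
              · congr 2
                funext k
                rw [lintegral_const_mul' _ _ (ENNReal.pow_ne_top ENNReal.ofReal_ne_top),
                  lintegral_indicator measurableSet_ball]
              · exact fun k =>
                  (((hGt t).indicator measurableSet_ball).const_mul _).aemeasurable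
    _ = b * ∑' k : ℕ, a ^ k * ∫⁻ t in Ioc 0 T, ∫⁻ y in ball (0 : R3) (lam ^ k), G y t := by
        rw [lintegral_const_mul' _ _ ENNReal.ofReal_ne_top, lintegral_tsum]
        · congr 2
          funext k
          rw [lintegral_const_mul' _ _ (ENNReal.pow_ne_top ENNReal.ofReal_ne_top)]
        · exact fun k => (hGm.lintegral_prod_left.const_mul _).aemeasurable
    _ ≤ b * ∑' k : ℕ, ENNReal.ofReal (lam ^ (-(1 / 2) : ℝ)) ^ k *
          ∫⁻ t in Ioc 0 T, ∫⁻ y in ball (0 : R3) 1, G y t := by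
        refine mul_le_mul_right (ENNReal.tsum_le_tsum fun k => ?_) _
        refine (mul_le_mul_right (lintegral_ball_pow_le hlam hG hT k) _).trans_eq ?_
        rw [← mul_assoc, ← mul_pow, ← ENNReal.ofReal_mul (by positivity), ← Real.rpow_natCast lam 2,
          ← Real.rpow_add h0]
        norm_num
    _ = _ := by rw [ENNReal.tsum_mul_right, mul_assoc]

lemma abs_Kker_sub_le {lam : ℝ} (hlam : 1 < lam) (i j : Fin 3) {x y : R3} (hx : ‖x‖ < lam)
    (hy : lam ^ 2 ≤ ‖y‖) :
    |Kker i j (x - y)| ≤ ((1 - 1 / lam) / 2) ^ (-3 : ℝ) * (1 + ‖y‖) ^ (-3 : ℝ) := by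
  have h0 : 0 < lam := one_pos.trans hlam
  have ha : 0 < (1 - 1 / lam) / 2 := by
    have : 1 / lam < 1 := (div_lt_one h0).2 hlam
    linarith
  have hy1 : 1 ≤ ‖y‖ := (one_le_pow₀ hlam.le).trans hy
  have hly : lam ≤ 1 / lam * ‖y‖ := by
    rw [one_div, inv_mul_eq_div, le_div_iff₀ h0, ← pow_two]
    exact hy
  have hxy : ‖y‖ - ‖x‖ ≤ ‖x - y‖ := by
    rw [norm_sub_rev]
    exact norm_sub_norm_le y x
  have hle : (1 - 1 / lam) / 2 * (1 + ‖y‖) ≤ ‖x - y‖ := by nlinarith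
  have hpos : 0 < (1 - 1 / lam) / 2 * (1 + ‖y‖) := by positivity
  calc _ ≤ ‖x - y‖ ^ (-3 : ℝ) := abs_Kker_le i j (norm_pos_iff.1 (hpos.trans_le hle))
    _ ≤ _ := Real.rpow_le_rpow_of_nonpos hpos hle (by norm_num)
    _ = _ := Real.mul_rpow ha.le (by positivity)

lemma rpow_enorm_far_field_le {lam : ℝ} (hlam : 1 < lam) {f : R3 → ℝ} (hf : Measurable f)
    (i j : Fin 3) {x : R3} (hx : ‖x‖ < lam) :
    ‖∫ y in {y : R3 | lam ^ 2 ≤ ‖y‖}, Kker i j (x - y) * f y‖ₑ ^ ((3 : ℝ) / 2)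
      ≤ ENNReal.ofReal (((1 - 1 / lam) / 2) ^ (-3 : ℝ)) ^ (3 / 2 : ℝ) *
          (∫⁻ y : R3, ENNReal.ofReal ((1 + ‖y‖) ^ (-4 : ℝ))) ^ (1 / 2 : ℝ) *
        ∫⁻ y in {y : R3 | lam ^ 2 ≤ ‖y‖},
          ‖f y‖ₑ ^ ((3 : ℝ) / 2) * ENNReal.ofReal ((1 + ‖y‖) ^ (-(5 / 2) : ℝ)) := by
  set s := {y : R3 | lam ^ 2 ≤ ‖y‖}
  have hs : MeasurableSet s := measurableSet_le measurable_const measurable_norm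
  set c := ENNReal.ofReal (((1 - 1 / lam) / 2) ^ (-3 : ℝ))
  set u : R3 → ℝ≥0∞ := fun y => ‖f y‖ₑ * ENNReal.ofReal ((1 + ‖y‖) ^ (-(5 / 3) : ℝ))
  set v : R3 → ℝ≥0∞ := fun y => ENNReal.ofReal ((1 + ‖y‖) ^ (-(4 / 3) : ℝ))
  have hw (y : R3) : 0 < 1 + ‖y‖ := by positivity
  have hpw (y : R3) (q r : ℝ) (hr : 0 ≤ r) : ENNReal.ofReal ((1 + ‖y‖) ^ q) ^ r
      = ENNReal.ofReal ((1 + ‖y‖) ^ (q * r)) := by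
    rw [ENNReal.ofReal_rpow_of_nonneg (Real.rpow_nonneg (hw y).le _) hr,
      ← Real.rpow_mul (hw y).le]
  have hu : ∫⁻ y in s, u y ^ ((3 : ℝ) / 2) = ∫⁻ y in s,
      ‖f y‖ₑ ^ ((3 : ℝ) / 2) * ENNReal.ofReal ((1 + ‖y‖) ^ (-(5 / 2) : ℝ)) := by
    refine lintegral_congr fun y => ?_
    rw [ENNReal.mul_rpow_of_nonneg _ _ (by norm_num), hpw y _ _ (by norm_num)]
    norm_num
  have hv : ∫⁻ y in s, v y ^ (3 : ℝ) ≤ ∫⁻ y : R3, ENNReal.ofReal ((1 + ‖y‖) ^ (-4 : ℝ)) := by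
    refine (setLIntegral_le_lintegral _ _).trans_eq (lintegral_congr fun y => ?_)
    rw [hpw y _ _ (by norm_num)]
    norm_num
  have hbound : ‖∫ y in s, Kker i j (x - y) * f y‖ₑ ≤ c * ∫⁻ y in s, (u * v) y := by
    rw [← lintegral_const_mul' _ _ ENNReal.ofReal_ne_top]
    refine (enorm_integral_le_lintegral_enorm _).trans (setLIntegral_mono' hs fun y hy => ?_)
    have hK : ‖Kker i j (x - y)‖ₑ ≤ c * ENNReal.ofReal ((1 + ‖y‖) ^ (-3 : ℝ)) := by
      rw [← ENNReal.ofReal_mul' (Real.rpow_nonneg (hw y).le _), ← ofReal_norm]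
      exact ENNReal.ofReal_le_ofReal (abs_Kker_sub_le hlam i j hx hy)
    have huv : (u * v) y = ENNReal.ofReal ((1 + ‖y‖) ^ (-3 : ℝ)) * ‖f y‖ₑ := by
      rw [Pi.mul_apply, mul_assoc, ← ENNReal.ofReal_mul (Real.rpow_nonneg (hw y).le _),
        ← Real.rpow_add (hw y), mul_comm]
      norm_num
    rw [enorm_mul, huv, ← mul_assoc]
    gcongr
  have hum : Measurable u := by fun_prop
  have hvm : Measurable v := by fun_prop
  have hpq : Real.HolderConjugate (3 / 2) 3 :=
    Real.holderConjugate_iff.2 ⟨by norm_num, by norm_num⟩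
  have hH := ENNReal.lintegral_mul_le_Lp_mul_Lq (volume.restrict s) hpq
    hum.aemeasurable hvm.aemeasurable
  rw [hu] at hH
  calc _ ≤ (c * ((∫⁻ y in s, ‖f y‖ₑ ^ ((3 : ℝ) / 2) *
          ENNReal.ofReal ((1 + ‖y‖) ^ (-(5 / 2) : ℝ))) ^ (1 / (3 / 2) : ℝ) *
        (∫⁻ y : R3, ENNReal.ofReal ((1 + ‖y‖) ^ (-4 : ℝ))) ^ (1 / 3 : ℝ))) ^ (3 / 2 : ℝ) := by
        refine ENNReal.rpow_le_rpow (hbound.trans ?_) (by norm_num)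
        gcongr
        refine hH.trans ?_
        gcongr
    _ = _ := by
        rw [ENNReal.mul_rpow_of_nonneg _ _ (by norm_num),
          ENNReal.mul_rpow_of_nonneg _ _ (by norm_num), ← ENNReal.rpow_mul, ← ENNReal.rpow_mul]
        norm_num
        ring

/-- the far-field part of the pressure,
`p(x,t) = ∫_{|y|≥λ²} K_{ij}(x−y) h(y,t) dy`, built from a scaling-invariant
`h(y,t) = λ² h(λy, λ²t)` with `h ∈ L^{3/2}(B₁×(0,T))`, satisfies
`∫₀^T∫_{B_λ} |p|^{3/2} ≤ C(λ) ∫₀^T∫_{B₁} |h|^{3/2}`, with `C(λ)` depending only on `λ`. -/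
theorem stmt17 (lam : ℝ) (hlam : 1 < lam) :
    ∃ C : ℝ≥0∞, C ≠ ⊤ ∧
      ∀ (T : ℝ), 0 < T →
      ∀ h : R3 → ℝ → ℝ,
        Measurable (fun q : R3 × ℝ => h q.1 q.2) →
        (∀ (y : R3) (t : ℝ), 0 < t → h y t = lam ^ 2 * h (lam • y) (lam ^ 2 * t)) →
        (∫⁻ t in Ioc (0:ℝ) T, ∫⁻ y in ball (0:R3) 1, (‖h y t‖₊ : ℝ≥0∞) ^ ((3:ℝ)/2)) < ⊤ →
        ∀ (i j : Fin 3) (p : R3 → ℝ → ℝ),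
        (∀ (x : R3) (t : ℝ),
          p x t = ∫ y in {y : R3 | lam ^ 2 ≤ ‖y‖}, Kker i j (x - y) * h y t) →
        (∫⁻ t in Ioc (0:ℝ) T, ∫⁻ x in ball (0:R3) lam, (‖p x t‖₊ : ℝ≥0∞) ^ ((3:ℝ)/2))
          ≤ C * ∫⁻ t in Ioc (0:ℝ) T, ∫⁻ y in ball (0:R3) 1, (‖h y t‖₊ : ℝ≥0∞) ^ ((3:ℝ)/2) := by
  have h0 : 0 < lam := one_pos.trans hlam
  set a : ℝ := (1 - 1 / lam) / 2
  set M : ℝ≥0∞ := ∫⁻ y : R3, ENNReal.ofReal ((1 + ‖y‖) ^ (-4 : ℝ))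
  have hM : M ≠ ⊤ := (finite_integral_one_add_norm (by simp; norm_num)).ne
  set D : ℝ≥0∞ := ENNReal.ofReal (a ^ (-3 : ℝ)) ^ (3 / 2 : ℝ) * M ^ (1 / 2 : ℝ)
  have hD : D ≠ ⊤ := ENNReal.mul_ne_top
    (ENNReal.rpow_ne_top_of_nonneg (by norm_num) ENNReal.ofReal_ne_top)
    (ENNReal.rpow_ne_top_of_nonneg (by norm_num) hM)
  set S : ℝ≥0∞ := ∑' k : ℕ, ENNReal.ofReal (lam ^ (-(1 / 2) : ℝ)) ^ k
  have hS : S ≠ ⊤ := by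
    have : ENNReal.ofReal (lam ^ (-(1 / 2) : ℝ)) < 1 := by
      rw [ENNReal.ofReal_lt_one]
      exact Real.rpow_lt_one_of_one_lt_of_neg hlam (by norm_num)
    rw [show S = _ from ENNReal.tsum_geometric _]
    exact ENNReal.inv_ne_top.2 (tsub_pos_of_lt this).ne'
  refine ⟨D * volume (ball (0 : R3) lam) * (ENNReal.ofReal (lam ^ (5 / 2 : ℝ)) * S),
    ENNReal.mul_ne_top (ENNReal.mul_ne_top hD measure_ball_lt_top.ne)
      (ENNReal.mul_ne_top ENNReal.ofReal_ne_top hS), ?_⟩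
  intro T hT h hm hscale _ i j p hp
  have hGm : Measurable fun q : R3 × ℝ => ‖h q.1 q.2‖ₑ ^ ((3 : ℝ) / 2) := by fun_prop
  have hG (y : R3) (t : ℝ) (ht : 0 < t) : ‖h y t‖ₑ ^ ((3 : ℝ) / 2)
      = ENNReal.ofReal (lam ^ 3) * ‖h (lam • y) (lam ^ 2 * t)‖ₑ ^ ((3 : ℝ) / 2) := by
    rw [hscale y t ht, enorm_mul, ENNReal.mul_rpow_of_nonneg _ _ (by norm_num),
      Real.enorm_of_nonneg (by positivity), ENNReal.ofReal_rpow_of_nonneg (by positivity)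
        (by norm_num), ← Real.rpow_natCast, ← Real.rpow_mul h0.le, ← Real.rpow_natCast]
    norm_num
  have hmain := lintegral_weight_le (G := fun y t => ‖h y t‖ₑ ^ ((3 : ℝ) / 2)) hlam hGm hG hT
  calc _ ≤ ∫⁻ t in Ioc 0 T, D * volume (ball (0 : R3) lam) *
        ∫⁻ y in {y : R3 | lam ^ 2 ≤ ‖y‖},
          ‖h y t‖ₑ ^ ((3 : ℝ) / 2) * ENNReal.ofReal ((1 + ‖y‖) ^ (-(5 / 2) : ℝ)) := by
        refine lintegral_mono fun t => ?_
        have hmt : Measurable fun y => h y t := hm.comp measurable_prodMk_right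
        refine (setLIntegral_mono' measurableSet_ball fun x hx => ?_).trans_eq
          ((setLIntegral_const _ (D * ∫⁻ y in {y : R3 | lam ^ 2 ≤ ‖y‖},
            ‖h y t‖ₑ ^ ((3 : ℝ) / 2) * ENNReal.ofReal ((1 + ‖y‖) ^ (-(5 / 2) : ℝ)))).trans
            (by ring))
        rw [hp x t]
        exact rpow_enorm_far_field_le hlam hmt i j (mem_ball_zero_iff.1 hx)
    _ = D * volume (ball (0 : R3) lam) * ∫⁻ t in Ioc 0 T,
        ∫⁻ y in {y : R3 | lam ^ 2 ≤ ‖y‖},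
          ‖h y t‖ₑ ^ ((3 : ℝ) / 2) * ENNReal.ofReal ((1 + ‖y‖) ^ (-(5 / 2) : ℝ)) :=
        lintegral_const_mul' _ _ (ENNReal.mul_ne_top hD measure_ball_lt_top.ne)
    _ ≤ _ := by
        rw [mul_assoc (D * _)]
        gcongr
        exact hmain
end
end
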